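/- Let Ω = (a,b)×(c,d) with a < b and c < d, and let β₁, β₂ ∈ ℝ. If v : ℝ² → ℝ is four times continuously differentiable and vanishes on ∂Ω, then ∫_Ω (β₁ v_x + β₂ v_y) · v_xxyy = −∫_Ω v_xy · (β₁ v_xxy + β₂ v_xyy). -/

import Mathlib

open MeasureTheory Set

/-- Partial derivative with respect to the first variable. -/
noncomputable def pdx (v : ℝ × ℝ → ℝ) : ℝ × ℝ → ℝ :=
  fun p => deriv (fun x => v (x, p.2)) p.1

/-- Partial derivative with respect to the second variable. -/
noncomputable def pdy (v : ℝ × ℝ → ℝ) : ℝ × ℝ → ℝ :=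
  fun p => deriv (fun y => v (p.1, y)) p.2


lemma pdx_eq_fd {v : ℝ × ℝ → ℝ} (hv : Differentiable ℝ v) :
    pdx v = fun p => fderiv ℝ v p (1, 0) := by
  funext p
  have h := (hv p).hasFDerivAt.comp_hasDerivAt (f := fun x : ℝ => (x, p.2)) p.1
    ((hasDerivAt_id p.1).prodMk (hasDerivAt_const p.1 p.2))
  exact h.deriv

lemma pdy_eq_fd {v : ℝ × ℝ → ℝ} (hv : Differentiable ℝ v) :
    pdy v = fun p => fderiv ℝ v p (0, 1) := by
  funext p
  have h := (hv p).hasFDerivAt.comp_hasDerivAt (f := fun y : ℝ => (p.1, y)) p.2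
    ((hasDerivAt_const p.2 p.1).prodMk (hasDerivAt_id p.2))
  exact h.deriv

lemma pdx_cd {v : ℝ × ℝ → ℝ} {m n : ℕ} (hv : ContDiff ℝ m v) (h : n + 1 ≤ m) :
    ContDiff ℝ n (pdx v) := by
  have hv' : ContDiff ℝ ((n : ℕ) + 1) v := hv.of_le (by exact_mod_cast h)
  rw [pdx_eq_fd (hv'.differentiable (by simp))]
  exact (hv'.fderiv_right le_rfl).clm_apply contDiff_const

lemma pdy_cd {v : ℝ × ℝ → ℝ} {m n : ℕ} (hv : ContDiff ℝ m v) (h : n + 1 ≤ m) :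
    ContDiff ℝ n (pdy v) := by
  have hv' : ContDiff ℝ ((n : ℕ) + 1) v := hv.of_le (by exact_mod_cast h)
  rw [pdy_eq_fd (hv'.differentiable (by simp))]
  exact (hv'.fderiv_right le_rfl).clm_apply contDiff_const

lemma pd_comm {v : ℝ × ℝ → ℝ} (hv : ContDiff ℝ (2 : ℕ) v) : pdy (pdx v) = pdx (pdy v) := by
  have h1 : ContDiff ℝ (1 : ℕ) (pdx v) := pdx_cd hv (by norm_num)
  have h2 : ContDiff ℝ (1 : ℕ) (pdy v) := pdy_cd hv (by norm_num)
  have hd : Differentiable ℝ v := hv.differentiable (by simp)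
  have hf : Differentiable ℝ (fderiv ℝ v) :=
    (hv.fderiv_right (m := 1) (by norm_num)).differentiable (by simp)
  rw [pdy_eq_fd (h1.differentiable (by simp)), pdx_eq_fd (h2.differentiable (by simp)),
    pdx_eq_fd hd, pdy_eq_fd hd]
  funext p
  have hs : IsSymmSndFDerivAt ℝ v p := hv.contDiffAt.isSymmSndFDerivAt (by simp)
  have e : ∀ w : ℝ × ℝ, ∀ z, fderiv ℝ (fun p => fderiv ℝ v p w) p z
      = fderiv ℝ (fderiv ℝ v) p z w := by
    intro w z
    rw [fderiv_clm_apply (hf p) (differentiableAt_const w)]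
    simp
  rw [e, e]
  exact hs _ _

lemma int_on {f : ℝ × ℝ → ℝ} (hf : Continuous f) (a b c d : ℝ) :
    IntegrableOn f (Ioo a b ×ˢ Ioo c d) (volume.prod volume) :=
  (hf.continuousOn.integrableOn_compact (isCompact_Icc.prod isCompact_Icc)).mono_set
    (prod_mono Ioo_subset_Icc_self Ioo_subset_Icc_self)

lemma ibp_one {f g : ℝ → ℝ} (hf : ContDiff ℝ (1 : ℕ) f) (hg : ContDiff ℝ (1 : ℕ) g) {c d : ℝ}
    (hcd : c < d) (h1 : f c = 0) (h2 : f d = 0) :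
    ∫ y in Ioo c d, f y * deriv g y = ∫ y in Ioo c d, -(deriv f y * g y) := by
  rw [← integral_Ioc_eq_integral_Ioo, ← integral_Ioc_eq_integral_Ioo,
    ← intervalIntegral.integral_of_le hcd.le, ← intervalIntegral.integral_of_le hcd.le,
    intervalIntegral.integral_mul_deriv_eq_deriv_mul (u' := deriv f)
      (fun x _ => (hf.differentiable (by simp) x).hasDerivAt)
      (fun x _ => (hg.differentiable (by simp) x).hasDerivAt)
      ((hf.continuous_deriv (by simp)).intervalIntegrable _ _)
      ((hg.continuous_deriv (by simp)).intervalIntegrable _ _), h1, h2]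
  simp

lemma ibp_y {u w : ℝ × ℝ → ℝ} (hu : ContDiff ℝ (1 : ℕ) u) (hw : ContDiff ℝ (1 : ℕ) w)
    {a b c d : ℝ} (hcd : c < d) (h : ∀ x ∈ Ioo a b, u (x, c) = 0 ∧ u (x, d) = 0) :
    ∫ p in Ioo a b ×ˢ Ioo c d, u p * pdy w p = ∫ p in Ioo a b ×ˢ Ioo c d, -(pdy u p * w p) := by
  have cu : Continuous (pdy u) := (pdy_cd (n := 0) hu (by norm_num)).continuous
  have cw : Continuous (pdy w) := (pdy_cd (n := 0) hw (by norm_num)).continuous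
  rw [Measure.volume_eq_prod]
  refine (setIntegral_prod _ (int_on (hu.continuous.mul cw) ..)).trans
    (Eq.trans ?_ (setIntegral_prod _ (int_on (cu.mul hw.continuous).neg ..)).symm)
  refine setIntegral_congr_fun measurableSet_Ioo fun x hx => ?_
  exact ibp_one (f := fun y => u (x, y)) (g := fun y => w (x, y))
    (hu.comp (contDiff_const.prodMk contDiff_id)) (hw.comp (contDiff_const.prodMk contDiff_id))
    hcd (h x hx).1 (h x hx).2

lemma ibp_x {u w : ℝ × ℝ → ℝ} (hu : ContDiff ℝ (1 : ℕ) u) (hw : ContDiff ℝ (1 : ℕ) w)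
    {a b c d : ℝ} (hab : a < b) (h : ∀ y ∈ Ioo c d, u (a, y) = 0 ∧ u (b, y) = 0) :
    ∫ p in Ioo a b ×ˢ Ioo c d, u p * pdx w p = ∫ p in Ioo a b ×ˢ Ioo c d, -(pdx u p * w p) := by
  have cu : Continuous (pdx u) := (pdx_cd (n := 0) hu (by norm_num)).continuous
  have cw : Continuous (pdx w) := (pdx_cd (n := 0) hw (by norm_num)).continuous
  have i1 := int_on (hu.continuous.mul cw) a b c d
  have i2 := int_on (cu.mul hw.continuous).neg a b c d
  rw [IntegrableOn, ← Measure.prod_restrict] at i1 i2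
  rw [Measure.volume_eq_prod, ← Measure.prod_restrict]
  refine (integral_prod_symm _ i1).trans (Eq.trans ?_ (integral_prod_symm _ i2).symm)
  refine setIntegral_congr_fun measurableSet_Ioo fun y hy => ?_
  exact ibp_one (f := fun x => u (x, y)) (g := fun x => w (x, y))
    (hu.comp (contDiff_id.prodMk contDiff_const)) (hw.comp (contDiff_id.prodMk contDiff_const))
    hab (h y hy).1 (h y hy).2

theorem stmt_3 (a b c d : ℝ) (hab : a < b) (hcd : c < d) (β₁ β₂ : ℝ)
    (v : ℝ × ℝ → ℝ) (hv : ContDiff ℝ 4 v)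
    (hbc1 : ∀ x ∈ Icc a b, v (x, c) = 0 ∧ v (x, d) = 0)
    (hbc2 : ∀ y ∈ Icc c d, v (a, y) = 0 ∧ v (b, y) = 0) :
    (∫ p in (Ioo a b) ×ˢ (Ioo c d),
        (β₁ * pdx v p + β₂ * pdy v p) * pdx (pdx (pdy (pdy v))) p) =
      -∫ p in (Ioo a b) ×ˢ (Ioo c d),
          pdx (pdy v) p * (β₁ * pdx (pdx (pdy v)) p + β₂ * pdx (pdy (pdy v)) p) := by
  have hv4 : ContDiff ℝ (4 : ℕ) v := by exact_mod_cast hv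
  have hx : ContDiff ℝ (3 : ℕ) (pdx v) := pdx_cd hv4 (by norm_num)
  have hy : ContDiff ℝ (3 : ℕ) (pdy v) := pdy_cd hv4 (by norm_num)
  have hxy : ContDiff ℝ (2 : ℕ) (pdx (pdy v)) := pdx_cd hy (by norm_num)
  have hyy : ContDiff ℝ (2 : ℕ) (pdy (pdy v)) := pdy_cd hy (by norm_num)
  have hxxy : ContDiff ℝ (1 : ℕ) (pdx (pdx (pdy v))) := pdx_cd hxy (by norm_num)
  have hxyy : ContDiff ℝ (1 : ℕ) (pdx (pdy (pdy v))) := pdx_cd hyy (by norm_num)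
  have h4 : ContDiff ℝ (0 : ℕ) (pdx (pdx (pdy (pdy v)))) := pdx_cd hxyy (by norm_num)
  have e1 : pdy (pdx v) = pdx (pdy v) := pd_comm (hv4.of_le (by norm_num))
  have e2 : pdy (pdx (pdx (pdy v))) = pdx (pdx (pdy (pdy v))) := by
    rw [pd_comm hxy, pd_comm (hy.of_le (by norm_num))]
  have A := ibp_y (u := pdx v) (hx.of_le (by norm_num)) hxxy (a := a) (b := b) hcd (by
    intro x hx'
    have key : ∀ t, (∀ x ∈ Icc a b, v (x, t) = 0) → pdx v (x, t) = 0 := by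
      intro t ht
      have : (fun x => v (x, t)) =ᶠ[nhds x] fun _ => 0 := by
        filter_upwards [Icc_mem_nhds hx'.1 hx'.2] with z hz using ht z hz
      simpa [pdx] using this.deriv_eq
    exact ⟨key c fun x h => (hbc1 x h).1, key d fun x h => (hbc1 x h).2⟩)
  have B := ibp_x (u := pdy v) (hy.of_le (by norm_num)) hxyy (c := c) (d := d) hab (by
    intro y hy'
    have key : ∀ t, (∀ y ∈ Icc c d, v (t, y) = 0) → pdy v (t, y) = 0 := by
      intro t ht
      have : (fun y => v (t, y)) =ᶠ[nhds y] fun _ => 0 := by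
        filter_upwards [Icc_mem_nhds hy'.1 hy'.2] with z hz using ht z hz
      simpa [pdy] using this.deriv_eq
    exact ⟨key a fun x h => (hbc2 x h).1, key b fun x h => (hbc2 x h).2⟩)
  rw [e1, e2] at A
  have I1 := int_on (hx.continuous.mul h4.continuous) a b c d
  have I2 := int_on (hy.continuous.mul h4.continuous) a b c d
  have I3 := int_on (hxy.continuous.mul hxxy.continuous).neg a b c d
  have I4 := int_on (hxy.continuous.mul hxyy.continuous).neg a b c d
  rw [← Measure.volume_eq_prod] at I1 I2 I3 I4
  have L := integral_add (I1.const_mul β₁) (I2.const_mul β₂)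
  have R := integral_add (I3.const_mul β₁) (I4.const_mul β₂)
  simp only [integral_const_mul, Pi.mul_apply, Pi.neg_apply] at L R
  rw [← integral_neg]
  refine Eq.trans (Eq.trans ?_ (L.trans (Eq.trans ?_ R.symm))) ?_
  · congr 1; funext p; ring
  · rw [A, B]
  · congr 1; funext p; ring
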